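/- Let K be a field that is an algebra over ℂ. If X, Y ∈ ℂ², ψ₂(X,Y) is a rational number, and X ≠ Y, then every unit-distance preserving map f : ℂ² → K² satisfies ψ₂(f(X),f(Y)) = ψ₂(X,Y) (computed in K via the algebra map) and f(X) ≠ f(Y). -/

import Mathlib

/-- `ψ₂((x₁,x₂),(y₁,y₂)) = (x₁−y₁)² + (x₂−y₂)²` on `K²`. -/
def psi2 (K : Type*) [Field K] (x y : Fin 2 → K) : K := (x 0 - y 0) ^ 2 + (x 1 - y 1) ^ 2

/-- `f` preserves the value `z` of `ψ₂`. -/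
def PreservesPsi {K : Type*} [Field K] [Algebra ℂ K] (f : (Fin 2 → ℂ) → (Fin 2 → K))
    (z : ℂ) : Prop :=
  ∀ U V : Fin 2 → ℂ, psi2 ℂ U V = z → psi2 K (f U) (f V) = algebraMap ℂ K z

/-- Every unit-distance preserving map `ℂ² → K²` preserves the value `z` of `ψ₂`. -/
def IsRigidValue (K : Type*) [Field K] [Algebra ℂ K] (z : ℂ) : Prop :=
  ∀ f : (Fin 2 → ℂ) → (Fin 2 → K), PreservesPsi f 1 → PreservesPsi f z

section Plane

variable {F : Type*} [Field F]

theorem psi2_smul (r : F) (x y : Fin 2 → F) :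
    psi2 F (r • x) (r • y) = r ^ 2 * psi2 F x y := by
  simp only [psi2, Pi.smul_apply, smul_eq_mul]
  ring

/-- The opposite vertices of a rhombus coincide or satisfy the parallelogram law. -/
theorem eq_or_psi2_eq_of_rhombus {a b : F} (ha : a ≠ 0) {A D P Q : Fin 2 → F}
    (hPQ : psi2 F P Q = a) (hAP : psi2 F A P = b) (hAQ : psi2 F A Q = b)
    (hDP : psi2 F D P = b) (hDQ : psi2 F D Q = b) (h2 : (2 : F) ≠ 0) :
    A = D ∨ psi2 F A D = 4 * b - a := by
  simp only [psi2] at *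
  set c := (Q 0 - P 0) * (A 1 - D 1) - (Q 1 - P 1) * (A 0 - D 0) with hc
  have hperp : (Q 0 - P 0) * (A 0 - D 0) + (Q 1 - P 1) * (A 1 - D 1) = 0 := by
    apply mul_left_cancel₀ h2
    linear_combination hAP - hAQ - hDP + hDQ
  have h0 : a * (A 0 - D 0) = -(Q 1 - P 1) * c := by
    rw [hc]; linear_combination (Q 0 - P 0) * hperp - (A 0 - D 0) * hPQ
  have h1 : a * (A 1 - D 1) = (Q 0 - P 0) * c := by
    rw [hc]; linear_combination (Q 1 - P 1) * hperp - (A 1 - D 1) * hPQ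
  by_cases hc0 : c = 0
  · left
    rw [hc0, mul_zero] at h0 h1
    funext i
    fin_cases i
    · exact sub_eq_zero.1 ((mul_eq_zero.1 h0).resolve_left ha)
    · exact sub_eq_zero.1 ((mul_eq_zero.1 h1).resolve_left ha)
  · right
    have hpar : (A 0 + D 0 - 2 * P 0) * -(Q 1 - P 1)
        + (A 1 + D 1 - 2 * P 1) * (Q 0 - P 0) = 0 := by
      apply mul_left_cancel₀ hc0
      linear_combination a * hAP - a * hDP - (A 0 + D 0 - 2 * P 0) * h0
        - (A 1 + D 1 - 2 * P 1) * h1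
    have hdot : (A 0 + D 0 - 2 * P 0) * (Q 0 - P 0)
        + (A 1 + D 1 - 2 * P 1) * (Q 1 - P 1) = a := by
      apply mul_left_cancel₀ h2
      linear_combination hAP - hAQ + hDP - hDQ + 2 * hPQ
    have e0 : A 0 + D 0 - 2 * P 0 = Q 0 - P 0 := by
      apply mul_left_cancel₀ ha
      linear_combination (Q 0 - P 0) * hdot - (Q 1 - P 1) * hpar
        - (A 0 + D 0 - 2 * P 0) * hPQ
    have e1 : A 1 + D 1 - 2 * P 1 = Q 1 - P 1 := by
      apply mul_left_cancel₀ ha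
      linear_combination (Q 1 - P 1) * hdot + (Q 0 - P 0) * hpar
        - (A 1 + D 1 - 2 * P 1) * hPQ
    linear_combination 2 * hAP + 2 * hDP - hPQ
      - (A 0 + D 0 - 2 * P 0 + (Q 0 - P 0)) * e0 - (A 1 + D 1 - 2 * P 1 + (Q 1 - P 1)) * e1

/-- In the plane, degenerate triangle equality forces a midpoint. -/
theorem add_eq_two_mul_of_psi2 {a : F} (ha : a ≠ 0) (h2 : (2 : F) ≠ 0) {A M B : Fin 2 → F}
    (hAM : psi2 F A M = a) (hMB : psi2 F M B = a) (hAB : psi2 F A B = 4 * a) (i : Fin 2) :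
    A i + B i = 2 * M i := by
  simp only [psi2] at *
  have hdot : (M 0 - A 0) * (B 0 - M 0) + (M 1 - A 1) * (B 1 - M 1) = a := by
    apply mul_left_cancel₀ h2
    linear_combination hAB - hAM - hMB
  have hdet : (M 0 - A 0) * (B 1 - M 1) - (M 1 - A 1) * (B 0 - M 0) = 0 := by
    apply pow_eq_zero_iff (two_ne_zero) |>.1
    linear_combination ((M 0 - B 0) ^ 2 + (M 1 - B 1) ^ 2) * hAM + a * hMB
      - ((M 0 - A 0) * (B 0 - M 0) + (M 1 - A 1) * (B 1 - M 1) + a) * hdot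
  apply mul_left_cancel₀ ha
  fin_cases i
  · change a * (A 0 + B 0) = a * (2 * M 0)
    linear_combination (M 0 - A 0) * hdot - (M 1 - A 1) * hdet - (B 0 - M 0) * hAM
  · change a * (A 1 + B 1) = a * (2 * M 1)
    linear_combination (M 1 - A 1) * hdot + (M 0 - A 0) * hdet - (B 1 - M 1) * hAM

/-- Four times the Gram determinant of a triangle with squared sides `pq`, `pr`, `qr`. -/
def triangleGram (pq pr qr : F) : F := 4 * pr * qr - (pr + qr - pq) ^ 2

/-- The squared distance of two points, from their squared distances to a triangle. -/
theorem triangleGram_mul_psi2 (P Q R A B : Fin 2 → F) :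
    let p := psi2 F P R
    let q := psi2 F Q R
    let m := p + q - psi2 F P Q
    let a := psi2 F A R
    let b := psi2 F B R
    let ap := a + p - psi2 F A P
    let aq := a + q - psi2 F A Q
    let bp := b + p - psi2 F B P
    let bq := b + q - psi2 F B Q
    triangleGram (psi2 F P Q) p q * psi2 F A B =
      triangleGram (psi2 F P Q) p q * (a + b)
        - (2 * q * ap * bp + 2 * p * aq * bq - m * (ap * bq + aq * bp)) := by
  simp only [psi2, triangleGram]
  ring

end Plane

section Rigid

variable {K : Type*} [Field K] [Algebra ℂ K]

/-- Two points at preserved distances from a nondegenerate triangle with preserved sides are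
at preserved distance. -/
theorem psi2_map_of_triangle {f : (Fin 2 → ℂ) → (Fin 2 → K)} {P Q R A B : Fin 2 → ℂ}
    (hne : triangleGram (psi2 ℂ P Q) (psi2 ℂ P R) (psi2 ℂ Q R) ≠ 0)
    (hPQ : psi2 K (f P) (f Q) = algebraMap ℂ K (psi2 ℂ P Q))
    (hPR : psi2 K (f P) (f R) = algebraMap ℂ K (psi2 ℂ P R))
    (hQR : psi2 K (f Q) (f R) = algebraMap ℂ K (psi2 ℂ Q R))
    (hAP : psi2 K (f A) (f P) = algebraMap ℂ K (psi2 ℂ A P))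
    (hAQ : psi2 K (f A) (f Q) = algebraMap ℂ K (psi2 ℂ A Q))
    (hAR : psi2 K (f A) (f R) = algebraMap ℂ K (psi2 ℂ A R))
    (hBP : psi2 K (f B) (f P) = algebraMap ℂ K (psi2 ℂ B P))
    (hBQ : psi2 K (f B) (f Q) = algebraMap ℂ K (psi2 ℂ B Q))
    (hBR : psi2 K (f B) (f R) = algebraMap ℂ K (psi2 ℂ B R)) :
    psi2 K (f A) (f B) = algebraMap ℂ K (psi2 ℂ A B) := by
  have hC := congrArg (algebraMap ℂ K) (triangleGram_mul_psi2 P Q R A B)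
  have hK := triangleGram_mul_psi2 (f P) (f Q) (f R) (f A) (f B)
  have hne' := (map_ne_zero (algebraMap ℂ K)).2 hne
  simp only [hPQ, hPR, hQR, hAP, hAQ, hAR, hBP, hBQ, hBR] at hK
  simp only [triangleGram, map_mul, map_add, map_sub, map_pow, map_ofNat] at hC hK hne'
  exact mul_left_cancel₀ hne' (hK.trans hC.symm)

theorem two_ne_zero_of_algebra_complex (K : Type*) [Field K] [Algebra ℂ K] : (2 : K) ≠ 0 := by
  have := (map_ne_zero (algebraMap ℂ K)).2 (two_ne_zero (α := ℂ))
  rwa [map_ofNat] at this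

theorem IsRigidValue.one : IsRigidValue K 1 := fun _ hf => hf

/-- The rhombus step, with the collapse excluded by a spindle of third side `e`. -/
theorem IsRigidValue.four_mul_sub_of_ne {a b e : ℂ} (ha : IsRigidValue K a)
    (hb : IsRigidValue K b) (he : IsRigidValue K e) (ha0 : a ≠ 0) (hc0 : 4 * b - a ≠ 0)
    (he0 : e ≠ 0) (hec : e ≠ 4 * b - a) : IsRigidValue K (4 * b - a) := by
  intro f hf
  have key : ∀ U V : Fin 2 → ℂ, psi2 ℂ U V = 4 * b - a →
      f U = f V ∨ psi2 K (f U) (f V) = algebraMap ℂ K (4 * b - a) := by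
    intro U V hUV
    obtain ⟨s, hs⟩ := IsAlgClosed.exists_pow_nat_eq (a / (4 * (4 * b - a))) two_pos
    have hs' : 4 * s ^ 2 * (4 * b - a) = a := by rw [hs]; field_simp
    let P : Fin 2 → ℂ := ![(U 0 + V 0) / 2 - s * (V 1 - U 1), (U 1 + V 1) / 2 + s * (V 0 - U 0)]
    let Q : Fin 2 → ℂ := ![(U 0 + V 0) / 2 + s * (V 1 - U 1), (U 1 + V 1) / 2 - s * (V 0 - U 0)]
    have hPQ : psi2 ℂ P Q = a := by
      simp only [psi2, P, Q, Matrix.cons_val_zero, Matrix.cons_val_one] at hUV ⊢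
      linear_combination 4 * s ^ 2 * hUV + hs'
    have hUP : psi2 ℂ U P = b := by
      simp only [psi2, P, Matrix.cons_val_zero, Matrix.cons_val_one] at hUV ⊢
      linear_combination (s ^ 2 + 1 / 4) * hUV + hs' / 4
    have hUQ : psi2 ℂ U Q = b := by
      simp only [psi2, Q, Matrix.cons_val_zero, Matrix.cons_val_one] at hUV ⊢
      linear_combination (s ^ 2 + 1 / 4) * hUV + hs' / 4
    have hVP : psi2 ℂ V P = b := by
      simp only [psi2, P, Matrix.cons_val_zero, Matrix.cons_val_one] at hUV ⊢
      linear_combination (s ^ 2 + 1 / 4) * hUV + hs' / 4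
    have hVQ : psi2 ℂ V Q = b := by
      simp only [psi2, Q, Matrix.cons_val_zero, Matrix.cons_val_one] at hUV ⊢
      linear_combination (s ^ 2 + 1 / 4) * hUV + hs' / 4
    have h := eq_or_psi2_eq_of_rhombus ((map_ne_zero (algebraMap ℂ K)).2 ha0)
      (ha f hf _ _ hPQ) (hb f hf _ _ hUP) (hb f hf _ _ hUQ) (hb f hf _ _ hVP)
      (hb f hf _ _ hVQ) (two_ne_zero_of_algebra_complex K)
    simpa only [map_sub, map_mul, map_ofNat] using h
  intro U V hUV
  refine (key U V hUV).resolve_left fun hfUV => ?_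
  set c := 4 * b - a with hc
  obtain ⟨s, hs⟩ := IsAlgClosed.exists_pow_nat_eq (1 - (1 - e / (2 * c)) ^ 2) two_pos
  have ht : (1 - e / (2 * c)) * (2 * c) = 2 * c - e := by field_simp
  set t := 1 - e / (2 * c)
  let W : Fin 2 → ℂ :=
    ![U 0 + t * (V 0 - U 0) - s * (V 1 - U 1), U 1 + t * (V 1 - U 1) + s * (V 0 - U 0)]
  have hUW : psi2 ℂ U W = c := by
    simp only [psi2, W, Matrix.cons_val_zero, Matrix.cons_val_one] at hUV ⊢
    linear_combination (s ^ 2 + t ^ 2) * hUV + c * hs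
  have hVW : psi2 ℂ V W = e := by
    simp only [psi2, W, Matrix.cons_val_zero, Matrix.cons_val_one] at hUV ⊢
    linear_combination (s ^ 2 + (1 - t) ^ 2) * hUV + c * hs - ht
  have hfe : psi2 K (f U) (f W) = algebraMap ℂ K e := hfUV ▸ he f hf _ _ hVW
  rcases key U W hUW with h | h
  · rw [h] at hfe
    exact (map_ne_zero (algebraMap ℂ K)).2 he0 (by rw [← hfe]; simp [psi2])
  · exact hec ((algebraMap ℂ K).injective (hfe.symm.trans h))

theorem IsRigidValue.three : IsRigidValue K 3 := by
  have h := IsRigidValue.one (K := K).four_mul_sub_of_ne IsRigidValue.one IsRigidValue.one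
    one_ne_zero (by norm_num) one_ne_zero (by norm_num)
  norm_num at h
  exact h

theorem IsRigidValue.four_mul_sub {a b : ℂ} (ha : IsRigidValue K a)
    (hb : IsRigidValue K b) (ha0 : a ≠ 0) (hc0 : 4 * b - a ≠ 0) :
    IsRigidValue K (4 * b - a) := by
  by_cases h : 4 * b - a = 1
  · rw [h]; exact IsRigidValue.one
  · exact ha.four_mul_sub_of_ne hb IsRigidValue.one ha0 hc0 one_ne_zero (Ne.symm h)

theorem IsRigidValue.four : IsRigidValue K 4 := by
  intro f hf A B hAB
  obtain ⟨s, hs⟩ := IsAlgClosed.exists_pow_nat_eq (3 : ℂ) two_pos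
  let P : Fin 2 → ℂ := ![(A 0 + B 0) / 2, (A 1 + B 1) / 2]
  let Q : Fin 2 → ℂ := ![A 0 + (B 0 - A 0) / 4 - s * (B 1 - A 1) / 4,
    A 1 + (B 1 - A 1) / 4 + s * (B 0 - A 0) / 4]
  let R : Fin 2 → ℂ := ![A 0 + 3 * (B 0 - A 0) / 4 - s * (B 1 - A 1) / 4,
    A 1 + 3 * (B 1 - A 1) / 4 + s * (B 0 - A 0) / 4]
  have hPQ : psi2 ℂ P Q = 1 := by
    simp only [psi2, P, Q, Matrix.cons_val_zero, Matrix.cons_val_one] at hAB ⊢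
    linear_combination (1 + s ^ 2) / 16 * hAB + hs / 4
  have hPR : psi2 ℂ P R = 1 := by
    simp only [psi2, P, R, Matrix.cons_val_zero, Matrix.cons_val_one] at hAB ⊢
    linear_combination (1 + s ^ 2) / 16 * hAB + hs / 4
  have hQR : psi2 ℂ Q R = 1 := by
    simp only [psi2, Q, R, Matrix.cons_val_zero, Matrix.cons_val_one] at hAB ⊢
    linear_combination hAB / 4
  have hAP : psi2 ℂ A P = 1 := by
    simp only [psi2, P, Matrix.cons_val_zero, Matrix.cons_val_one] at hAB ⊢
    linear_combination hAB / 4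
  have hBP : psi2 ℂ B P = 1 := by
    simp only [psi2, P, Matrix.cons_val_zero, Matrix.cons_val_one] at hAB ⊢
    linear_combination hAB / 4
  have hAQ : psi2 ℂ A Q = 1 := by
    simp only [psi2, Q, Matrix.cons_val_zero, Matrix.cons_val_one] at hAB ⊢
    linear_combination (1 + s ^ 2) / 16 * hAB + hs / 4
  have hAR : psi2 ℂ A R = 3 := by
    simp only [psi2, R, Matrix.cons_val_zero, Matrix.cons_val_one] at hAB ⊢
    linear_combination (9 + s ^ 2) / 16 * hAB + hs / 4
  have hBQ : psi2 ℂ B Q = 3 := by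
    simp only [psi2, Q, Matrix.cons_val_zero, Matrix.cons_val_one] at hAB ⊢
    linear_combination (9 + s ^ 2) / 16 * hAB + hs / 4
  have hBR : psi2 ℂ B R = 1 := by
    simp only [psi2, R, Matrix.cons_val_zero, Matrix.cons_val_one] at hAB ⊢
    linear_combination (1 + s ^ 2) / 16 * hAB + hs / 4
  have h1 : ∀ U V, psi2 ℂ U V = 1 → psi2 K (f U) (f V) = algebraMap ℂ K (psi2 ℂ U V) :=
    fun U V h => by rw [h]; exact hf U V h
  have h3 : ∀ U V, psi2 ℂ U V = 3 → psi2 K (f U) (f V) = algebraMap ℂ K (psi2 ℂ U V) :=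
    fun U V h => by rw [h]; exact IsRigidValue.three f hf U V h
  rw [← hAB]
  exact psi2_map_of_triangle (by rw [hPQ, hPR, hQR]; norm_num [triangleGram])
    (h1 _ _ hPQ) (h1 _ _ hPR) (h1 _ _ hQR) (h1 _ _ hAP) (h1 _ _ hAQ) (h3 _ _ hAR)
    (h1 _ _ hBP) (h3 _ _ hBQ) (h1 _ _ hBR)

theorem IsRigidValue.mul {a b : ℂ} (ha : IsRigidValue K a) (hb : IsRigidValue K b)
    (ha0 : a ≠ 0) : IsRigidValue K (a * b) := by
  intro f hf U V hUV
  obtain ⟨r, hr⟩ := IsAlgClosed.exists_pow_nat_eq a two_pos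
  have hr0 : r ≠ 0 := by
    rintro rfl
    exact ha0 (by rw [← hr]; norm_num)
  have hrK := (map_ne_zero (algebraMap ℂ K)).2 hr0
  have haK : algebraMap ℂ K a = algebraMap ℂ K r ^ 2 := by rw [← hr, map_pow]
  have hg : PreservesPsi (fun x => (algebraMap ℂ K r)⁻¹ • f (r • x)) 1 := by
    intro x y hxy
    rw [psi2_smul, ha f hf _ _ (by rw [psi2_smul, hxy, hr, mul_one]), haK, map_one]
    field_simp
  have h := hb _ hg (r⁻¹ • U) (r⁻¹ • V) (by rw [psi2_smul, hUV, ← hr]; field_simp)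
  simp only [smul_inv_smul₀ hr0, psi2_smul] at h
  rw [map_mul, haK, ← h]
  field_simp

theorem map_add_nat_smul_of_psi2_eq_one {f : (Fin 2 → ℂ) → (Fin 2 → K)}
    (hf : PreservesPsi f 1) {Z X : Fin 2 → ℂ} (hZX : psi2 ℂ Z X = 1) (n : ℕ) :
    f (Z + (n : ℂ) • (X - Z)) = f Z + (n : K) • (f X - f Z) := by
  induction n using Nat.twoStepInduction with
  | zero => simp
  | one => simp
  | more n ih0 ih1 =>
    funext i
    have hstep : ∀ z : ℂ, psi2 ℂ (Z + z • (X - Z)) (Z + (z + 1) • (X - Z)) = 1 := by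
      intro z
      simp only [psi2, Pi.add_apply, Pi.smul_apply, Pi.sub_apply, smul_eq_mul] at hZX ⊢
      linear_combination hZX
    have hstep2 : psi2 ℂ (Z + (n : ℂ) • (X - Z)) (Z + ((n : ℂ) + 1 + 1) • (X - Z)) = 4 := by
      simp only [psi2, Pi.add_apply, Pi.smul_apply, Pi.sub_apply, smul_eq_mul] at hZX ⊢
      linear_combination 4 * hZX
    have h := add_eq_two_mul_of_psi2 (a := (1 : K)) one_ne_zero
      (two_ne_zero_of_algebra_complex K)
      (by simpa using hf _ _ (hstep n)) (by simpa using hf _ _ (hstep (n + 1)))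
      (by simpa only [map_ofNat, mul_one] using IsRigidValue.four f hf _ _ hstep2) i
    push_cast at ih1 ⊢
    rw [ih0, ih1] at h
    rw [show (n : ℂ) + 2 = n + 1 + 1 by ring]
    simp only [Pi.add_apply, Pi.smul_apply, Pi.sub_apply, smul_eq_mul] at h ⊢
    linear_combination h

theorem IsRigidValue.div_sq {d : ℂ} (hd : IsRigidValue K d) (hd0 : d ≠ 0) {n : ℕ}
    (hn : n ≠ 0) : IsRigidValue K (d / (n : ℂ) ^ 2) := by
  have hnC : (n : ℂ) ≠ 0 := Nat.cast_ne_zero.2 hn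
  intro f hf X Y hXY
  set c := d / (n : ℂ) ^ 2 with hc
  have hc0 : c ≠ 0 := div_ne_zero hd0 (pow_ne_zero 2 hnC)
  obtain ⟨s, hs⟩ := IsAlgClosed.exists_pow_nat_eq (1 / c - 1 / 4) two_pos
  have hs' : s ^ 2 * c + c / 4 = 1 := by rw [hs]; field_simp; ring
  let Z : Fin 2 → ℂ := ![(X 0 + Y 0) / 2 - s * (Y 1 - X 1), (X 1 + Y 1) / 2 + s * (Y 0 - X 0)]
  have hZX : psi2 ℂ Z X = 1 := by
    simp only [psi2, Z, Matrix.cons_val_zero, Matrix.cons_val_one] at hXY ⊢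
    linear_combination (s ^ 2 + 1 / 4) * hXY + hs'
  have hZY : psi2 ℂ Z Y = 1 := by
    simp only [psi2, Z, Matrix.cons_val_zero, Matrix.cons_val_one] at hXY ⊢
    linear_combination (s ^ 2 + 1 / 4) * hXY + hs'
  have hcd : (n : ℂ) ^ 2 * c = d := by rw [hc]; field_simp
  have h := hd f hf (Z + (n : ℂ) • (X - Z)) (Z + (n : ℂ) • (Y - Z)) (by
    rw [← hcd, ← hXY]
    simp only [psi2, Pi.add_apply, Pi.smul_apply, Pi.sub_apply, smul_eq_mul]
    ring)
  rw [map_add_nat_smul_of_psi2_eq_one hf hZX, map_add_nat_smul_of_psi2_eq_one hf hZY, ← hcd,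
    map_mul, map_pow, map_natCast] at h
  have hnK : (n : K) ≠ 0 := by
    rw [← map_natCast (algebraMap ℂ K)]
    exact (map_ne_zero (algebraMap ℂ K)).2 hnC
  apply mul_left_cancel₀ (pow_ne_zero 2 hnK)
  rw [← h]
  simp only [psi2, Pi.add_apply, Pi.smul_apply, Pi.sub_apply, smul_eq_mul]
  ring

theorem IsRigidValue.sub {a b : ℂ} (ha : IsRigidValue K a) (hb : IsRigidValue K b)
    (hb0 : b ≠ 0) (hab : a ≠ b) : IsRigidValue K (a - b) := by
  have h4 : (4 : ℂ) ≠ 0 := by norm_num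
  have hne : 4 * a - 4 * b ≠ 0 := by
    rw [← mul_sub]
    exact mul_ne_zero h4 (sub_ne_zero.2 hab)
  have h := ((IsRigidValue.four.mul hb h4).four_mul_sub ha
    (mul_ne_zero h4 hb0) hne).div_sq hne two_ne_zero
  convert h using 1
  push_cast
  ring

theorem IsRigidValue.neg_one : IsRigidValue K (-1) := by
  have h2 : IsRigidValue K (3 - 1) :=
    IsRigidValue.three.sub IsRigidValue.one one_ne_zero (by norm_num)
  have h := IsRigidValue.one.sub h2 (by norm_num) (by norm_num)
  norm_num at h
  exact h

theorem IsRigidValue.natCast_add_one (n : ℕ) : IsRigidValue K ((n : ℂ) + 1) := by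
  induction n with
  | zero => simpa using IsRigidValue.one
  | succ n ih =>
    have h := ih.sub IsRigidValue.neg_one (by norm_num) (by
      intro h
      have : ((n + 2 : ℕ) : ℂ) = 0 := by push_cast; linear_combination h
      exact absurd (Nat.cast_eq_zero.1 this) (by omega))
    convert h using 1
    push_cast
    ring

theorem IsRigidValue.intCast {m : ℤ} (hm : m ≠ 0) : IsRigidValue K (m : ℂ) := by
  obtain ⟨n, hn⟩ := Nat.exists_eq_succ_of_ne_zero (Int.natAbs_ne_zero.2 hm)
  have hpos := IsRigidValue.natCast_add_one (K := K) n
  rcases Int.natAbs_eq m with h | h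
  · rw [h, hn]
    simpa using hpos
  · rw [h, hn]
    convert IsRigidValue.neg_one.mul hpos (by norm_num) using 1
    push_cast
    ring

theorem IsRigidValue.ratCast {q : ℚ} (hq : q ≠ 0) : IsRigidValue K (q : ℂ) := by
  have hm : q.num * q.den ≠ 0 := mul_ne_zero (Rat.num_ne_zero.2 hq) (by exact_mod_cast q.den_nz)
  have hden : (q.den : ℂ) ≠ 0 := Nat.cast_ne_zero.2 q.den_nz
  convert (IsRigidValue.intCast hm).div_sq (Int.cast_ne_zero.2 hm) q.den_nz using 1
  rw [Rat.cast_def]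
  push_cast
  field_simp

/-- Distinct points at isotropic distance stay distinct and at isotropic distance. -/
theorem psi2_map_eq_zero_and_ne {f : (Fin 2 → ℂ) → (Fin 2 → K)} (hf : PreservesPsi f 1)
    {X Y : Fin 2 → ℂ} (hXY : X ≠ Y) (h0 : psi2 ℂ X Y = 0) :
    psi2 K (f X) (f Y) = 0 ∧ f X ≠ f Y := by
  have hw : Y 0 - X 0 ≠ 0 := by
    intro hw
    refine hXY (funext fun i => ?_)
    have h1 : (X 1 - Y 1) ^ 2 = 0 := by
      simp only [psi2] at h0
      linear_combination h0 - (Y 0 - X 0) * hw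
    fin_cases i
    · exact (sub_eq_zero.1 hw).symm
    · exact sub_eq_zero.1 (pow_eq_zero_iff two_ne_zero |>.1 h1)
  obtain ⟨k, hk⟩ : ∃ k : ℂ, 4 * k * (Y 0 - X 0) ^ 2 = 1 :=
    ⟨(4 * (Y 0 - X 0) ^ 2)⁻¹, by field_simp⟩
  let T : ℂ → ℂ → Fin 2 → ℂ := fun s t =>
    ![X 0 + s * (Y 0 - X 0) + t * k * (Y 0 - X 0), X 1 + s * (Y 1 - X 1) - t * k * (Y 1 - X 1)]
  have hT : ∀ s t s' t', psi2 ℂ (T s t) (T s' t') = (s - s') * (t - t') := by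
    intro s t s' t'
    simp only [psi2, T, Matrix.cons_val_zero, Matrix.cons_val_one] at h0 ⊢
    linear_combination (s - s') * (t - t') * hk
      + ((s - s') - (t - t') * k) ^ 2 * h0
  have hX : T 0 0 = X := by
    funext i
    fin_cases i <;> simp [T]
  have hY : T 1 0 = Y := by
    funext i
    fin_cases i <;> simp [T]
  have hrig : ∀ s t s' t' : ℤ, (s - s') * (t - t') ≠ 0 →
      psi2 K (f (T s t)) (f (T s' t')) = algebraMap ℂ K (psi2 ℂ (T s t) (T s' t')) := by
    intro s t s' t' h
    refine IsRigidValue.intCast h f hf _ _ ?_ |>.trans ?_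
    all_goals rw [hT]; push_cast; rfl
  have hPQ := hrig 2 1 3 (-1) (by norm_num)
  have hPR := hrig 2 1 (-1) 2 (by norm_num)
  have hQR := hrig 3 (-1) (-1) 2 (by norm_num)
  have hXP := hrig 0 0 2 1 (by norm_num)
  have hXQ := hrig 0 0 3 (-1) (by norm_num)
  have hXR := hrig 0 0 (-1) 2 (by norm_num)
  have hYP := hrig 1 0 2 1 (by norm_num)
  have hYQ := hrig 1 0 3 (-1) (by norm_num)
  have hYR := hrig 1 0 (-1) 2 (by norm_num)
  have h := psi2_map_of_triangle (by simp only [hT]; norm_num [triangleGram])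
    hPQ hPR hQR hXP hXQ hXR hYP hYQ hYR
  simp only [Int.cast_zero, Int.cast_one, hX, hY, h0, map_zero] at h hXP hYP
  refine ⟨h, fun hfXY => ?_⟩
  rw [hfXY, hYP] at hXP
  have hinj := (algebraMap ℂ K).injective hXP
  rw [← hX, ← hY, hT, hT] at hinj
  norm_num at hinj

end Rigid

/-- Let `K` be a field extending `ℂ`. If `X, Y ∈ ℂ²`, `ψ₂(X,Y)` is rational and
`X ≠ Y`, then every unit-distance preserving map `f : ℂ² → K²` satisfies
`ψ₂(f(X),f(Y)) = ψ₂(X,Y)` and `f(X) ≠ f(Y)`. -/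
theorem stmt17 (K : Type*) [Field K] [Algebra ℂ K] (X Y : Fin 2 → ℂ)
    (hq : ∃ q : ℚ, (q : ℂ) = psi2 ℂ X Y) (hXY : X ≠ Y)
    (f : (Fin 2 → ℂ) → (Fin 2 → K))
    (hf : ∀ U V : Fin 2 → ℂ, psi2 ℂ U V = 1 → psi2 K (f U) (f V) = 1) :
    psi2 K (f X) (f Y) = algebraMap ℂ K (psi2 ℂ X Y) ∧ f X ≠ f Y := by
  have hf' : PreservesPsi f 1 := fun U V h => by rw [hf U V h, map_one]
  by_cases h0 : psi2 ℂ X Y = 0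
  · rw [h0, map_zero]
    exact psi2_map_eq_zero_and_ne hf' hXY h0
  · obtain ⟨q, hq⟩ := hq
    have hq0 : q ≠ 0 := by
      rintro rfl
      exact h0 (by rw [← hq, Rat.cast_zero])
    have h := IsRigidValue.ratCast hq0 f hf' X Y hq.symm
    rw [hq] at h
    refine ⟨h, fun hfXY => (map_ne_zero (algebraMap ℂ K)).2 h0 ?_⟩
    rw [← h, hfXY]
    simp [psi2]
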